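/- Let x ∈ ℝⁿ be a fixed vector, let 0 < ε < 1 and 0 < δ < 1, and let Ω ∈ ℝ^{p×n} be a random matrix with i.i.d. standard Gaussian entries. If p ≥ (4/(ε²(1−ε)))·log(2/δ), then with probability at least 1 − δ the vector x satisfies the ε-JL condition under Ω, i.e. √(1-ε)·‖x‖₂ ≤ ‖(1/√p)·Ωx‖₂ ≤ √(1+ε)·‖x‖₂. -/

import Mathlib

open MeasureTheory ProbabilityTheory

/-- The law of a `p × n` random matrix with i.i.d. standard Gaussian entries. -/
noncomputable def gaussianMatrix (p n : ℕ) : Measure (Fin p → Fin n → ℝ) :=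
  Measure.pi fun _ : Fin p => Measure.pi fun _ : Fin n => gaussianReal 0 1

/-- Euclidean norm of a vector. -/
noncomputable def norm2 {k : ℕ} (v : Fin k → ℝ) : ℝ := Real.sqrt (∑ i, v i ^ 2)

lemma log_one_add_le_sub_sq_add_cube {u : ℝ} (hu : 0 ≤ u) :
    Real.log (1 + u) ≤ u - u ^ 2 / 2 + u ^ 3 / 2 := by
  have hd : ∀ x ∈ Set.Ici (0 : ℝ), HasDerivAt
      (fun x : ℝ => x - x ^ 2 / 2 + x ^ 3 / 2 - Real.log (1 + x))
      (1 - x + 3 / 2 * x ^ 2 - 1 / (1 + x)) x := by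
    intro x hx
    have hx0 : (0 : ℝ) ≤ x := hx
    have hlog := ((hasDerivAt_id' x).const_add 1).log (by positivity)
    have h2 := ((hasDerivAt_id' x).pow 2).div_const 2
    have h3 := ((hasDerivAt_id' x).pow 3).div_const 2
    refine ((((hasDerivAt_id' x).sub h2).add h3).sub hlog).congr_deriv ?_
    norm_num
    ring
  have hmono : MonotoneOn (fun x : ℝ => x - x ^ 2 / 2 + x ^ 3 / 2 - Real.log (1 + x))
      (Set.Ici 0) := by
    refine monotoneOn_of_hasDerivWithinAt_nonneg (convex_Ici 0)
      (fun x hx => (hd x hx).continuousAt.continuousWithinAt)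
      (fun x hx => (hd x (interior_subset hx)).hasDerivWithinAt) fun x hx => ?_
    have hx0 : (0 : ℝ) ≤ x := interior_subset hx
    have : 1 - x + 3 / 2 * x ^ 2 - 1 / (1 + x) = x ^ 2 * (1 + 3 * x) / (2 * (1 + x)) := by
      field_simp
      ring
    rw [this]
    positivity
  have := hmono (Set.mem_Ici.2 le_rfl) (Set.mem_Ici.2 hu) hu
  norm_num at this
  linarith

lemma log_one_sub_le_neg_sub_sq {u : ℝ} (hu : 0 ≤ u) (hu1 : u < 1) :
    Real.log (1 - u) ≤ -u - u ^ 2 / 2 := by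
  have h := Real.hasSum_pow_div_log_of_abs_lt_one (x := u) (by rwa [abs_of_nonneg hu])
  have := sum_le_hasSum (Finset.range 2) (fun i _ => by positivity) h
  norm_num [Finset.sum_range_succ] at this
  linarith

lemma integrable_exp_mul_sq_gaussianReal {t : ℝ} (ht : t < 1 / 2) :
    Integrable (fun y : ℝ => Real.exp (t * y ^ 2)) (gaussianReal 0 1) := by
  rw [gaussianReal_of_var_ne_zero _ one_ne_zero,
    integrable_withDensity_iff_integrable_smul' (measurable_gaussianPDF _ _)
      (Filter.Eventually.of_forall fun _ => gaussianPDF_lt_top)]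
  refine ((integrable_exp_neg_mul_sq (b := 1 / 2 - t) (by linarith)).const_mul
    (√(2 * Real.pi))⁻¹).congr (Filter.Eventually.of_forall fun y => ?_)
  simp only [toReal_gaussianPDF, gaussianPDFReal, smul_eq_mul, mul_assoc, ← Real.exp_add]
  norm_num
  left
  ring_nf

lemma mgf_sq_gaussianReal {t : ℝ} (ht : t < 1 / 2) :
    mgf (fun y : ℝ => y ^ 2) (gaussianReal 0 1) t = (√(1 - 2 * t))⁻¹ := by
  have h (y : ℝ) : gaussianPDFReal 0 1 y • Real.exp (t * y ^ 2) =
      (√(2 * Real.pi))⁻¹ * Real.exp (-(1 / 2 - t) * y ^ 2) := by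
    simp only [gaussianPDFReal, smul_eq_mul, mul_assoc, ← Real.exp_add]
    norm_num
    left
    ring_nf
  have hπ := Real.pi_pos
  have h1 : 0 < 1 - 2 * t := by linarith
  rw [mgf, integral_gaussianReal_eq_integral_smul one_ne_zero]
  simp_rw [h]
  rw [integral_const_mul, integral_gaussian, ← Real.sqrt_inv, ← Real.sqrt_inv,
    ← Real.sqrt_mul (by positivity)]
  congr 1
  have h2 : 1 / 2 - t ≠ 0 := by linarith
  field_simp

lemma integrable_exp_mul_sum_sq_pi_gaussianReal (p : ℕ) {t : ℝ} (ht : t < 1 / 2) :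
    Integrable (fun g : Fin p → ℝ => Real.exp (t * ∑ i, g i ^ 2))
      (Measure.pi fun _ => gaussianReal 0 1) := by
  simp_rw [Finset.mul_sum, Real.exp_sum]
  exact Integrable.fintype_prod fun _ => integrable_exp_mul_sq_gaussianReal ht

lemma mgf_sum_sq_pi_gaussianReal (p : ℕ) {t : ℝ} (ht : t < 1 / 2) :
    mgf (fun g : Fin p → ℝ => ∑ i, g i ^ 2) (Measure.pi fun _ => gaussianReal 0 1) t =
      (√(1 - 2 * t))⁻¹ ^ p := by
  simp_rw [mgf, Finset.mul_sum, Real.exp_sum]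
  rw [integral_fintype_prod_eq_prod (fun _ y => Real.exp (t * y ^ 2))]
  have := mgf_sq_gaussianReal ht
  rw [mgf] at this
  simp [this]

lemma exp_mul_inv_sqrt_pow (p : ℕ) {u : ℝ} (hu : -1 < u) :
    Real.exp (-(u / (2 * (1 + u))) * (p * (1 + u))) *
      (√(1 - 2 * (u / (2 * (1 + u)))))⁻¹ ^ p =
      Real.exp (-(p / 2 * (u - Real.log (1 + u)))) := by
  have h : 0 < 1 + u := by linarith
  have h1 : 1 - 2 * (u / (2 * (1 + u))) = (1 + u)⁻¹ := by
    field_simp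
    ring
  have h2 : √(1 + u) = Real.exp (Real.log (1 + u) / 2) := by
    rw [Real.exp_half, Real.exp_log h]
  rw [h1, Real.sqrt_inv, inv_inv, h2, ← Real.exp_nat_mul, ← Real.exp_add]
  congr 1
  field_simp
  ring

lemma measureReal_le_sum_sq_pi_gaussianReal (p : ℕ) {u : ℝ} (hu : 0 ≤ u) :
    (Measure.pi fun _ : Fin p => gaussianReal 0 1).real {g | p * (1 + u) ≤ ∑ i, g i ^ 2} ≤
      Real.exp (-(p / 2 * (u - Real.log (1 + u)))) := by
  have ht : u / (2 * (1 + u)) < 1 / 2 := by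
    rw [div_lt_div_iff₀ (by linarith) (by norm_num)]
    linarith
  rw [← exp_mul_inv_sqrt_pow p (by linarith), ← mgf_sum_sq_pi_gaussianReal p ht]
  exact measure_ge_le_exp_mul_mgf _ (by positivity)
    (integrable_exp_mul_sum_sq_pi_gaussianReal p ht)

lemma measureReal_sum_sq_le_pi_gaussianReal (p : ℕ) {u : ℝ} (hu : -1 < u) (hu0 : u ≤ 0) :
    (Measure.pi fun _ : Fin p => gaussianReal 0 1).real {g | ∑ i, g i ^ 2 ≤ p * (1 + u)} ≤
      Real.exp (-(p / 2 * (u - Real.log (1 + u)))) := by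
  have ht : u / (2 * (1 + u)) < 1 / 2 := by
    rw [div_lt_div_iff₀ (by linarith) (by norm_num)]
    linarith
  rw [← exp_mul_inv_sqrt_pow p hu, ← mgf_sum_sq_pi_gaussianReal p ht]
  exact measure_le_le_exp_mul_mgf _ (div_nonpos_of_nonpos_of_nonneg hu0 (by linarith))
    (integrable_exp_mul_sum_sq_pi_gaussianReal p ht)

lemma map_sum_eq_gaussianReal_of_iIndepFun {ι Ω : Type*} [MeasurableSpace Ω] {P : Measure Ω}
    [IsProbabilityMeasure P] {X : ι → Ω → ℝ} {v : ι → NNReal} (hX : iIndepFun X P)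
    (hm : ∀ i, Measurable (X i)) (hlaw : ∀ i, P.map (X i) = gaussianReal 0 (v i))
    (s : Finset ι) : P.map (∑ i ∈ s, X i) = gaussianReal 0 (∑ i ∈ s, v i) := by
  classical
  induction s using Finset.induction_on with
  | empty =>
    simp only [Finset.sum_empty, gaussianReal_zero_var]
    change P.map (fun _ => (0 : ℝ)) = _
    simp
  | insert i s hi ih =>
    rw [Finset.sum_insert hi, Finset.sum_insert hi]
    simpa using gaussianReal_add_gaussianReal_of_indepFun
      (hX.indepFun_finsetSum_of_notMem hm hi).symm (hlaw i) ih

lemma map_sum_mul_pi_gaussianReal {n : ℕ} {c : Fin n → ℝ} (hc : ∑ j, c j ^ 2 = 1) :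
    (Measure.pi fun _ : Fin n => gaussianReal 0 1).map (fun w => ∑ j, w j * c j) =
      gaussianReal 0 1 := by
  have h := map_sum_eq_gaussianReal_of_iIndepFun
    (P := Measure.pi fun _ : Fin n => gaussianReal 0 1)
    (X := fun j w => w j * c j) (v := fun j => NNReal.mk (c j ^ 2) (sq_nonneg _))
    (iIndepFun_pi (X := fun j y => y * c j) fun j => by fun_prop) (fun j => by fun_prop)
    (fun j => by
      have := gaussianReal_map_mul_const (μ := 0) (v := 1) (c j)
      rw [← (measurePreserving_eval (fun _ : Fin n => gaussianReal 0 1) j).map_eq,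
        Measure.map_map (by fun_prop) (by fun_prop)] at this
      simpa [Function.comp_def] using this) Finset.univ
  have hv : ∑ j, NNReal.mk (c j ^ 2) (sq_nonneg _) = 1 := by
    ext
    simpa using hc
  rw [hv] at h
  simpa only [Finset.sum_fn] using h

lemma map_mulVec_gaussianMatrix (p : ℕ) {n : ℕ} {c : Fin n → ℝ} (hc : ∑ j, c j ^ 2 = 1) :
    (gaussianMatrix p n).map (fun Ω i => ∑ j, Ω i j * c j) =
      Measure.pi fun _ : Fin p => gaussianReal 0 1 := by
  have h := map_sum_mul_pi_gaussianReal hc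
  have : SigmaFinite ((Measure.pi fun _ : Fin n => gaussianReal 0 1).map
      fun w => ∑ j, w j * c j) := by
    rw [h]
    infer_instance
  rw [gaussianMatrix, Measure.pi_map_pi (f := fun _ (w : Fin n → ℝ) => ∑ j, w j * c j)
    (fun _ => Measurable.aemeasurable (by fun_prop)), h]

lemma measurableSet_le_sum_sq_le {p : ℕ} (a b : ℝ) :
    MeasurableSet {g : Fin p → ℝ | a ≤ ∑ i, g i ^ 2 ∧ ∑ i, g i ^ 2 ≤ b} :=
  (measurableSet_le (f := fun _ : Fin p → ℝ => a) (g := fun g => ∑ i, g i ^ 2)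
    (by fun_prop) (by fun_prop)).inter
    (measurableSet_le (f := fun g : Fin p → ℝ => ∑ i, g i ^ 2) (g := fun _ => b)
      (by fun_prop) (by fun_prop))

lemma ofReal_one_sub_le_pi_gaussianReal {p : ℕ} {ε δ : ℝ} (hε0 : 0 < ε) (hε1 : ε < 1)
    (hδ0 : 0 < δ) (hp : 4 / (ε ^ 2 * (1 - ε)) * Real.log (2 / δ) ≤ (p : ℝ)) :
    ENNReal.ofReal (1 - δ) ≤ (Measure.pi fun _ : Fin p => gaussianReal 0 1)
      {g | p * (1 - ε) ≤ ∑ i, g i ^ 2 ∧ ∑ i, g i ^ 2 ≤ p * (1 + ε)} := by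
  set P := Measure.pi fun _ : Fin p => gaussianReal 0 1
  set G := {g : Fin p → ℝ | p * (1 - ε) ≤ ∑ i, g i ^ 2 ∧ ∑ i, g i ^ 2 ≤ p * (1 + ε)}
  have htail {u : ℝ} (hu : ε ^ 2 * (1 - ε) / 2 ≤ u - Real.log (1 + u)) :
      Real.exp (-(p / 2 * (u - Real.log (1 + u)))) ≤ δ / 2 := by
    have hε : 0 < ε ^ 2 * (1 - ε) := mul_pos (by positivity) (by linarith)
    rw [← Real.le_log_iff_exp_le (by positivity), ← inv_div 2 δ, Real.log_inv]
    rw [div_mul_eq_mul_div, div_le_iff₀ hε] at hp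
    have := mul_le_mul_of_nonneg_left hu (Nat.cast_nonneg (α := ℝ) p)
    linarith
  have hG : MeasurableSet G := measurableSet_le_sum_sq_le _ _
  have hupper := (measureReal_le_sum_sq_pi_gaussianReal p hε0.le).trans <| htail <| by
    linarith [log_one_add_le_sub_sq_add_cube hε0.le]
  have hlower := (measureReal_sum_sq_le_pi_gaussianReal p (u := -ε) (by linarith)
      (by linarith)).trans <| htail <| by
    have : 0 < ε ^ 3 := by positivity
    have := log_one_sub_le_neg_sub_sq hε0.le hε1
    rw [← sub_eq_add_neg]
    linarith
  have hcompl : P.real Gᶜ ≤ δ := by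
    refine (measureReal_mono (s₂ := {g | ∑ i, g i ^ 2 ≤ p * (1 + -ε)} ∪
      {g | p * (1 + ε) ≤ ∑ i, g i ^ 2}) fun g hg => ?_).trans
      ((measureReal_union_le _ _).trans (by linarith))
    by_contra hcon
    simp only [Set.mem_union, Set.mem_ofPred_eq, not_or, not_le] at hcon
    exact hg ⟨by linarith [hcon.1], hcon.2.le⟩
  rw [probReal_compl_eq_one_sub hG] at hcompl
  rw [← ofReal_measureReal]
  exact ENNReal.ofReal_le_ofReal (by linarith)

lemma norm2_const_mul {k : ℕ} {a : ℝ} (ha : 0 ≤ a) (v : Fin k → ℝ) :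
    norm2 (fun i => a * v i) = a * norm2 v := by
  simp_rw [norm2, mul_pow, ← Finset.mul_sum]
  rw [Real.sqrt_mul (sq_nonneg a), Real.sqrt_sq ha]

/-- If `p ≥ (4/(ε²(1-ε))) log(2/δ)`, then with probability at least `1 - δ` a fixed vector
`x ∈ ℝⁿ` satisfies the ε-JL condition under a `p × n` i.i.d. standard Gaussian matrix `Ω`:
`√(1-ε) ‖x‖₂ ≤ ‖(1/√p) Ω x‖₂ ≤ √(1+ε) ‖x‖₂`. -/
theorem stmt1 (n p : ℕ) (x : Fin n → ℝ) (ε δ : ℝ) (hε0 : 0 < ε) (hε1 : ε < 1)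
    (hδ0 : 0 < δ) (hδ1 : δ < 1)
    (hp : 4 / (ε ^ 2 * (1 - ε)) * Real.log (2 / δ) ≤ (p : ℝ)) :
    ENNReal.ofReal (1 - δ) ≤
      gaussianMatrix p n
        {Ω | Real.sqrt (1 - ε) * norm2 x ≤
              norm2 (fun i => (1 / Real.sqrt (p : ℝ)) * ∑ j, Ω i j * x j) ∧
            norm2 (fun i => (1 / Real.sqrt (p : ℝ)) * ∑ j, Ω i j * x j) ≤
              Real.sqrt (1 + ε) * norm2 x} := by
  have hp0 : (0 : ℝ) < p := by
    have : 0 < Real.log (2 / δ) := Real.log_pos (by rw [lt_div_iff₀ hδ0]; linarith)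
    exact lt_of_lt_of_le (mul_pos (div_pos (by norm_num)
      (mul_pos (by positivity) (by linarith))) this) hp
  have hN : 0 ≤ norm2 x := Real.sqrt_nonneg _
  rcases hN.eq_or_lt with h0 | hpos
  · have hx (j : Fin n) : x j = 0 := by
      have h := (Real.sqrt_eq_zero (Finset.sum_nonneg fun i _ => sq_nonneg (x i))).1 h0.symm
      exact pow_eq_zero_iff two_ne_zero |>.1
        ((Finset.sum_eq_zero_iff_of_nonneg fun i _ => sq_nonneg (x i)).1 h j (Finset.mem_univ j))
    have : IsProbabilityMeasure (gaussianMatrix p n) := by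
      unfold gaussianMatrix
      infer_instance
    simp [hx, norm2, hδ0.le]
  · have hc : ∑ j, (x j / norm2 x) ^ 2 = 1 := by
      have hsq : norm2 x ^ 2 = ∑ j, x j ^ 2 :=
        Real.sq_sqrt (Finset.sum_nonneg fun i _ => sq_nonneg (x i))
      simp_rw [div_pow, ← Finset.sum_div, ← hsq]
      exact div_self (by positivity)
    refine (ofReal_one_sub_le_pi_gaussianReal hε0 hε1 hδ0 hp).trans ?_
    rw [← map_mulVec_gaussianMatrix p hc, Measure.map_apply (by fun_prop)
      (measurableSet_le_sum_sq_le _ _)]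
    refine measure_mono fun Ω hΩ => ?_
    obtain ⟨h1, h2⟩ := hΩ
    set g : Fin p → ℝ := fun i => ∑ j, Ω i j * (x j / norm2 x) with hg
    have hrow (i : Fin p) : ∑ j, Ω i j * x j = norm2 x * g i := by
      rw [hg, Finset.mul_sum]
      refine Finset.sum_congr rfl fun j _ => ?_
      field_simp
    have hnorm : norm2 (fun i => (1 / √(p : ℝ)) * ∑ j, Ω i j * x j) =
        √((∑ i, g i ^ 2) / p) * norm2 x := by
      simp_rw [hrow]
      rw [norm2_const_mul (by positivity) fun i => norm2 x * g i, norm2_const_mul hN g,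
        Real.sqrt_div (Finset.sum_nonneg fun i _ => sq_nonneg (g i))]
      simp only [norm2]
      ring
    rw [Set.mem_ofPred_eq, hnorm]
    constructor
    · gcongr
      rw [le_div_iff₀ hp0]
      linarith
    · gcongr
      rw [div_le_iff₀ hp0]
      linarith
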